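/- arXiv:math/0409517 — 3 statements merged into one kernel-verified Lean document; each statement's English description precedes it below -/
import Mathlib

section
/- If R is a commutative arithmetic ring of Krull dimension 0, then the λ-dimension of R is at most 2. -/
open DirectSum

universe u

/-- A finite `n`-presentation of an `R`-module `E`: an exact sequence
`F_n → ⋯ → F_1 → F_0 → E → 0` with each `F_i` a finitely generated free module. -/
def HasFiniteNPresentation (R : Type u) [CommRing R] (E : Type u) [AddCommGroup E]
    [Module R E] (n : ℕ) : Prop :=
  ∃ (k : ℕ → ℕ) (f : ∀ i : ℕ, ((Fin (k (i + 1)) → R) →ₗ[R] (Fin (k i) → R)))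
    (g : ((Fin (k 0) → R) →ₗ[R] E)),
    Function.Surjective g ∧
    (0 < n → LinearMap.range (f 0) = LinearMap.ker g) ∧
    (∀ i : ℕ, i + 1 < n → LinearMap.range (f (i + 1)) = LinearMap.ker (f i))

/-- `λ-dim R ≤ n` : every module having a finite `n`-presentation has finite
`m`-presentations for all `m`, i.e. `λ_R(E) ≥ n → λ_R(E) = ∞`. -/
def LambdaDimLE (R : Type u) [CommRing R] (n : ℕ) : Prop :=
  ∀ (E : Type u) [AddCommGroup E] [Module R E],
    HasFiniteNPresentation R E n → ∀ m : ℕ, HasFiniteNPresentation R E m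

/-- `R` is arithmetic: the localization at every maximal ideal is a valuation ring,
i.e. its ideals are totally ordered by inclusion. -/
def IsArithmetic (R : Type u) [CommRing R] : Prop :=
  ∀ (M : Ideal R) (hM : M.IsMaximal),
    letI := hM.isPrime
    ∀ I J : Ideal (Localization.AtPrime M), I ≤ J ∨ J ≤ I

/-- `R` is self fp-injective: `Ext¹_R(F, R) = 0` for every finitely presented module `F`. -/
def SelfFPInjective (R : Type u) [CommRing R] : Prop :=
  ∀ (F : ModuleCat.{u} R), Module.FinitePresentation R F →
    Subsingleton (((Ext R (ModuleCat.{u} R) 1).obj (Opposite.op F)).obj (ModuleCat.of R R))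

/-- A coherent ring: every finitely generated ideal is finitely presented. -/
def IsCoherentRing (R : Type u) [CommRing R] : Prop :=
  ∀ I : Ideal R, I.FG → Module.FinitePresentation R I

/-- flat dimension of `E` at most `n`: the least `m` such that
`Tor_{m+1}(F, E) = 0` for all `F` is at most `n`. -/
def FlatDimLE (R : Type u) [CommRing R] (E : Type u) [AddCommGroup E] [Module R E]
    (n : ℕ) : Prop :=
  ∃ m ≤ n, ∀ (F : Type u) [AddCommGroup F] [Module R F],
    Subsingleton (((CategoryTheory.Tor (ModuleCat.{u} R) (m + 1)).obj (ModuleCat.of R F)).obj (ModuleCat.of R E))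

/-- Hermite ring. -/
def IsHermiteRing (R : Type u) [CommRing R] : Prop :=
  ∀ a b : R, ∃ d a' b' : R, a = d * a' ∧ b = d * b' ∧
    Ideal.span {a'} + Ideal.span {b'} = ⊤

/-- Kaplansky (elementary divisor) ring. -/
def IsKaplanskyRing (R : Type u) [CommRing R] : Prop :=
  ∀ (m n : ℕ) (A : Matrix (Fin m) (Fin n) R),
    ∃ (P : Matrix (Fin m) (Fin m) R) (Q : Matrix (Fin n) (Fin n) R),
      IsUnit P ∧ IsUnit Q ∧ ∀ (i : Fin m) (j : Fin n), (i : ℕ) ≠ (j : ℕ) → (P * A * Q) i j = 0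

/-- Adequate ring. -/
def IsAdequateRing (R : Type u) [CommRing R] : Prop :=
  IsBezout R ∧ ∀ a b : R, a ≠ 0 → ∃ r s : R,
    a = r * s ∧ Ideal.span {r} + Ideal.span {b} = ⊤ ∧
    ∀ s' : R, ¬ IsUnit s' → s' ∣ s → Ideal.span {s'} + Ideal.span {b} ≠ ⊤

/-- The minimal prime spectrum with the subspace topology from `Spec R`. -/
def MinSpec (R : Type u) [CommRing R] : Type u :=
  {P : PrimeSpectrum R // P.asIdeal ∈ minimalPrimes R}

instance (R : Type u) [CommRing R] : TopologicalSpace (MinSpec R) :=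
  instTopologicalSpaceSubtype

/-- Fractionally self fp-injective: for every proper ideal `A`, the classical
quotient ring `Q(R/A)` is self fp-injective. -/
def FractionallySelfFPInjective (R : Type u) [CommRing R] : Prop :=
  ∀ A : Ideal R, A ≠ ⊤ → SelfFPInjective (FractionRing (R ⧸ A))

/-- CF ring: every finite direct sum of cyclic modules has a canonical form. -/
def IsCFRing (R : Type u) [CommRing R] : Prop :=
  ∀ (n : ℕ) (I : Fin n → Ideal R),
    ∃ (m : ℕ) (J : Fin m → Ideal R),
      (∀ i j : Fin m, i ≤ j → J i ≤ J j) ∧ (∀ j : Fin m, J j ≠ ⊤) ∧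
      Nonempty ((⨁ i, R ⧸ I i) ≃ₗ[R] (⨁ j, R ⧸ J j))

section ZeroDimensional

variable {R : Type*} [CommRing R]

theorem exists_pow_mul_one_sub_mul_eq_zero
    (hdim : ∀ P : Ideal R, P.IsPrime → P.IsMaximal) (s : R) :
    ∃ (n : ℕ) (r : R), s ^ n * (1 - s * r) = 0 := by
  by_contra! h
  let S : Submonoid R :=
    { carrier := {x | ∃ (n : ℕ) (r : R), x = s ^ n * (1 - s * r)}
      one_mem' := ⟨0, 0, by simp⟩
      mul_mem' := by
        rintro _ _ ⟨n, r, rfl⟩ ⟨m, t, rfl⟩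
        exact ⟨n + m, r + t - s * r * t, by ring⟩ }
  have hS : Disjoint ((⊥ : Ideal R) : Set R) S := by
    rw [Set.disjoint_left]
    rintro x hx ⟨n, r, rfl⟩
    exact h n r hx
  obtain ⟨P, hP, -, hPS⟩ := Ideal.exists_le_prime_disjoint _ S hS
  rw [Set.disjoint_left] at hPS
  have hs : s ∉ P := fun hs => hPS hs ⟨1, 0, by simp⟩
  obtain ⟨y, hy⟩ := (hdim P hP).exists_inv hs
  obtain ⟨i, hi, hyi⟩ := hy
  refine hPS hi ⟨0, y, ?_⟩
  linear_combination hyi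

theorem exists_isIdempotentElem_dvd_notMem
    (hdim : ∀ P : Ideal R, P.IsPrime → P.IsMaximal) (M : Ideal R) [hM : M.IsPrime]
    {s : R} (hs : s ∉ M) : ∃ e : R, IsIdempotentElem e ∧ s ∣ e ∧ e ∉ M := by
  obtain ⟨n, r, h⟩ := exists_pow_mul_one_sub_mul_eq_zero hdim s
  have hpow (k : ℕ) : s ^ n = s ^ n * (s * r) ^ k := by
    induction k with
    | zero => simp
    | succ k ih =>
      rw [pow_succ]
      linear_combination ih * (s * r) + h
  refine ⟨(s * r) ^ (n + 1), ?_, ?_, fun he => ?_⟩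
  · have h1 : s ^ n = s ^ n * (s * r) ^ (n + 1) := hpow (n + 1)
    simp only [IsIdempotentElem]
    have h2 : (s * r) ^ (n + 1) = s ^ n * (s * r ^ (n + 1)) := by ring
    calc (s * r) ^ (n + 1) * (s * r) ^ (n + 1)
        = (s ^ n * (s * r) ^ (n + 1)) * (s * r ^ (n + 1)) := by ring
      _ = s ^ n * (s * r ^ (n + 1)) := by rw [← h1]
      _ = (s * r) ^ (n + 1) := h2.symm
  · exact (Dvd.intro _ rfl : s ∣ s * r).trans (dvd_pow_self _ n.succ_ne_zero)
  · refine hs (hM.mem_of_pow_mem n ?_)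
    rw [hpow (n + 1)]
    exact M.mul_mem_left _ he

end ZeroDimensional

section Arithmetic

variable {R : Type u} [CommRing R]

theorem IsArithmetic.exists_forall_dvd_mul (hR : IsArithmetic R) (M : Ideal R)
    (hM : M.IsMaximal) {ι : Type*} [Finite ι] [Nonempty ι] (a : ι → R) :
    ∃ k : ι, ∀ l : ι, ∃ s ∉ M, a k ∣ s * a l := by
  have := hM.isPrime
  obtain ⟨k, -, hk⟩ := Set.Finite.exists_maximalFor
    (fun i => Ideal.span {algebraMap R (Localization.AtPrime M) (a i)})
    Set.univ Set.finite_univ Set.univ_nonempty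
  refine ⟨k, fun l => ?_⟩
  have hle : Ideal.span {algebraMap R (Localization.AtPrime M) (a l)} ≤
      Ideal.span {algebraMap R (Localization.AtPrime M) (a k)} := by
    rcases hR M hM (Ideal.span {algebraMap R (Localization.AtPrime M) (a l)})
      (Ideal.span {algebraMap R (Localization.AtPrime M) (a k)}) with h | h
    · exact h
    · exact hk (Set.mem_univ l) h
  rw [Ideal.span_singleton_le_span_singleton] at hle
  obtain ⟨z, hz⟩ := hle
  obtain ⟨x, y, rfl⟩ := IsLocalization.exists_mk'_eq M.primeCompl z
  have hz' : algebraMap R (Localization.AtPrime M) (y * a l) =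
      algebraMap R (Localization.AtPrime M) (a k * x) := by
    rw [map_mul, map_mul, hz, mul_left_comm, mul_comm (algebraMap _ _ (y : R)),
      IsLocalization.mk'_spec]
  obtain ⟨c, hc⟩ := IsLocalization.exists_of_eq (M := M.primeCompl) hz'
  exact ⟨c * y, (c * y).2, c * x, by linear_combination hc⟩

theorem IsArithmetic.exists_isIdempotentElem_forall_dvd (hR : IsArithmetic R)
    (hdim : ∀ P : Ideal R, P.IsPrime → P.IsMaximal) (M : Ideal R) (hM : M.IsMaximal)
    {ι : Type*} [Finite ι] [Nonempty ι] (a : ι → R) :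
    ∃ e ∉ M, IsIdempotentElem e ∧ ∃ k : ι, ∀ l : ι, e * a k ∣ e * a l := by
  have := hM.isPrime
  have := Fintype.ofFinite ι
  obtain ⟨k, hk⟩ := hR.exists_forall_dvd_mul M hM a
  choose s hs hdvd using hk
  have hprod : ∏ l, s l ∉ M := by
    rw [Ideal.IsPrime.prod_mem_iff]
    simpa using hs
  obtain ⟨e, he, hse, heM⟩ := exists_isIdempotentElem_dvd_notMem hdim M hprod
  refine ⟨e, heM, he, k, fun l => ?_⟩
  have h : a k ∣ e * a l :=
    (hdvd l).trans (mul_dvd_mul_right ((Finset.dvd_prod_of_mem s (Finset.mem_univ l)).trans hse) _)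
  have h' := mul_dvd_mul_left e h
  rwa [← mul_assoc, he.eq] at h'

/-- In a zero-dimensional arithmetic ring principal ideals are annihilators. -/
theorem IsArithmetic.dvd_of_forall_mul_eq_zero (hR : IsArithmetic R)
    (hdim : ∀ P : Ideal R, P.IsPrime → P.IsMaximal) {a c : R}
    (h : ∀ x, x * a = 0 → x * c = 0) : a ∣ c := by
  by_contra hac
  have hne : (Ideal.span {a}).colon {c} ≠ ⊤ := by
    rw [Ne, Ideal.eq_top_iff_one, Submodule.mem_colon_singleton]
    simpa [Ideal.mem_span_singleton] using hac
  obtain ⟨M, hM, hle⟩ := Ideal.exists_le_maximal _ hne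
  have hprime := hM.isPrime
  have hmem (x : R) (hx : a ∣ x * c) : x ∈ M :=
    hle (Submodule.mem_colon_singleton.mpr (Ideal.mem_span_singleton.mpr hx))
  obtain ⟨k, hk⟩ := hR.exists_forall_dvd_mul M hM ![a, c]
  fin_cases k
  · obtain ⟨s, hs, hd⟩ := hk 1
    exact hs (hmem s hd)
  · obtain ⟨s, hs, m, hd⟩ := hk 0
    replace hd : s * a = c * m := hd
    have hm : m ∈ M := hmem m ⟨s, by linear_combination -hd⟩
    obtain ⟨n, r, hn⟩ := exists_pow_mul_one_sub_mul_eq_zero hdim m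
    have ht : 1 - m * r ∉ M := fun ht =>
      hprime.ne_top (M.eq_top_iff_one.mpr (by
        have := M.add_mem ht (M.mul_mem_right r hm)
        simpa using this))
    have key (j : ℕ) : ∀ u ∉ M, u * m ^ j * c ≠ 0 := by
      induction j with
      | zero =>
        intro u hu h0
        exact hu (hmem u ((by simpa using h0 : u * c = 0) ▸ dvd_zero a))
      | succ j ih =>
        intro u hu h0
        refine ih (u * s) (hprime.mul_notMem hu hs) (h _ ?_)
        linear_combination u * m ^ j * hd + h0
    exact key n _ ht (by linear_combination c * hn)

end Arithmetic

section FinitePresentation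

theorem Module.FinitePresentation.of_retract {R N P : Type*} [CommRing R]
    [AddCommGroup N] [Module R N] [AddCommGroup P] [Module R P] [Module.FinitePresentation R P]
    (i : N →ₗ[R] P) (p : P →ₗ[R] N) (h : p ∘ₗ i = LinearMap.id) :
    Module.FinitePresentation R N := by
  refine Module.finitePresentation_of_surjective p
    (Function.LeftInverse.surjective (LinearMap.congr_fun h)) ?_
  rw [LinearMap.ker_eq_range_of_comp_eq_id h]
  exact .of_finite

/-- A module is finitely presented as soon as, for every maximal ideal `M`, some scalar outside
`M` acts on it through a finitely presented module. -/
theorem Module.FinitePresentation.of_forall_isMaximal {R N : Type u} [CommRing R]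
    [AddCommGroup N] [Module R N]
    (h : ∀ M : Ideal R, M.IsMaximal → ∃ e ∉ M, ∃ (P : Type u) (_ : AddCommGroup P)
      (_ : Module R P) (_ : Module.FinitePresentation R P) (i : N →ₗ[R] P) (p : P →ₗ[R] N),
      p ∘ₗ i = e • LinearMap.id) :
    Module.FinitePresentation R N := by
  let J : Ideal R :=
    { carrier := {e | ∃ (P : Type u) (_ : AddCommGroup P)
        (_ : Module R P) (_ : Module.FinitePresentation R P) (i : N →ₗ[R] P) (p : P →ₗ[R] N),
        p ∘ₗ i = e • LinearMap.id}
      zero_mem' := ⟨PUnit, inferInstance, inferInstance, inferInstance, 0, 0, by simp⟩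
      add_mem' := by
        rintro a b ⟨P, _, _, _, i, p, hp⟩ ⟨Q, _, _, _, j, q, hq⟩
        refine ⟨P × Q, inferInstance, inferInstance, inferInstance, i.prod j, p.coprod q, ?_⟩
        rw [LinearMap.coprod_comp_prod, hp, hq, add_smul]
      smul_mem' := by
        rintro c a ⟨P, _, _, _, i, p, hp⟩
        exact ⟨P, _, _, ‹_›, i, c • p, by rw [LinearMap.smul_comp, hp, smul_smul, smul_eq_mul]⟩ }
  have hJ : J = ⊤ := by
    by_contra hJ
    obtain ⟨M, hM, hle⟩ := Ideal.exists_le_maximal J hJ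
    obtain ⟨e, he, hP⟩ := h M hM
    exact he (hle hP)
  obtain ⟨P, _, _, _, i, p, hp⟩ := (Ideal.eq_top_iff_one J).mp hJ
  exact .of_retract i p (by rw [hp, one_smul])

theorem IsArithmetic.finitePresentation_ker_toSpanSingleton {R : Type u} [CommRing R]
    (hR : IsArithmetic R) (hdim : ∀ P : Ideal R, P.IsPrime → P.IsMaximal) (d : R)
    (hfg : (LinearMap.ker (LinearMap.toSpanSingleton R R d)).FG) :
    Module.FinitePresentation R (LinearMap.ker (LinearMap.toSpanSingleton R R d)) := by
  set I := LinearMap.ker (LinearMap.toSpanSingleton R R d) with hI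
  have hmem (x : R) : x ∈ I ↔ x * d = 0 := by simp [hI]
  classical
  obtain ⟨S, hS⟩ := hfg
  have : Nonempty (insert 0 S : Finset R) := (Finset.insert_nonempty 0 S).to_subtype
  refine .of_forall_isMaximal fun M hM => ?_
  obtain ⟨e, heM, he, ⟨c, hc⟩, hdvd⟩ := hR.exists_isIdempotentElem_forall_dvd hdim M hM
    (ι := (insert 0 S : Finset R)) (fun x => (x : R))
  have hcI : c ∈ I := by
    rcases Finset.mem_insert.mp hc with rfl | hc
    · exact I.zero_mem
    · exact hS ▸ Submodule.subset_span hc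
  have hle : ∀ x ∈ I, e * c ∣ e * x := by
    intro x hx
    rw [← hS] at hx
    induction hx using Submodule.span_induction with
    | mem x hx => exact hdvd ⟨x, Finset.mem_insert_of_mem hx⟩
    | zero => simp
    | add x y _ _ hx hy => rw [mul_add]; exact dvd_add hx hy
    | smul r x _ hx => rw [smul_eq_mul, mul_left_comm]; exact hx.mul_left r
  let g := LinearMap.toSpanSingleton R R (e * c)
  have hker : LinearMap.ker g.rangeRestrict = Ideal.span {1 - e, d} := by
    ext x
    rw [LinearMap.ker_rangeRestrict, LinearMap.mem_ker, Ideal.mem_span_pair]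
    simp only [g, LinearMap.toSpanSingleton_apply, smul_eq_mul]
    constructor
    · intro hx
      obtain ⟨y, hy⟩ : d ∣ x * e := hR.dvd_of_forall_mul_eq_zero hdim fun z hz => by
        obtain ⟨w, hw⟩ := hle z ((hmem z).mpr hz)
        linear_combination x * hw + w * hx
      exact ⟨x, y, by linear_combination -hy⟩
    · rintro ⟨y, z, rfl⟩
      linear_combination (-y * c) * he.eq + z * e * (hmem c).mp hcI
  have : Module.FinitePresentation R (LinearMap.range g) :=
    Module.finitePresentation_of_surjective g.rangeRestrict g.surjective_rangeRestrict
      (hker ▸ ⟨{1 - e, d}, by simp⟩)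
  refine ⟨e, heM, LinearMap.range g, inferInstance, inferInstance, this,
    (e • I.subtype).codRestrict _ ?_, (LinearMap.range g).subtype.codRestrict I ?_, ?_⟩
  · rintro ⟨x, hx⟩
    obtain ⟨w, hw⟩ := hle x hx
    exact ⟨w, by simp [g, hw, mul_comm]⟩
  · rintro ⟨_, y, rfl⟩
    exact I.smul_mem _ (I.smul_mem e hcI)
  · ext x
    simp

variable {R F G : Type*} [CommRing R] [AddCommGroup F] [Module R F] [AddCommGroup G] [Module R G]

/-- If `A = d • A'` and `ψ ∘ A'` takes the value `1` at `b`, then the kernel of `A` is the direct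
sum of a copy of the annihilator of `d` and a summand of the kernel of `A ∘ π`, where `π` is the
projection along `b`. -/
theorem finitePresentation_ker_smul_of_apply_eq_one {d : R} {A' : F →ₗ[R] G} {ψ : G →ₗ[R] R}
    {b : F} (hb : ψ (A' b) = 1)
    (hann : (LinearMap.ker (LinearMap.toSpanSingleton R R d)).FG →
      Module.FinitePresentation R (LinearMap.ker (LinearMap.toSpanSingleton R R d)))
    (hker : (LinearMap.ker ((d • A') ∘ₗ (LinearMap.id - (ψ ∘ₗ A').smulRight b))).FG →
      Module.FinitePresentation R
        (LinearMap.ker ((d • A') ∘ₗ (LinearMap.id - (ψ ∘ₗ A').smulRight b))))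
    (hfg : (LinearMap.ker (d • A')).FG) :
    Module.FinitePresentation R (LinearMap.ker (d • A')) := by
  set π : F →ₗ[R] F := LinearMap.id - (ψ ∘ₗ A').smulRight b with hπ
  set K := LinearMap.ker (d • A')
  set L := LinearMap.ker ((d • A') ∘ₗ π)
  set I := LinearMap.ker (LinearMap.toSpanSingleton R R d)
  have hπx (x : F) : π x = x - ψ (A' x) • b := by simp [hπ]
  have hπb : π b = 0 := by simp [hπx, hb]
  have hK (x : F) : x ∈ K ↔ d • A' x = 0 := by simp [K]
  have hL (x : F) : x ∈ L ↔ d • A' (π x) = 0 := by simp [L]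
  have hI (t : R) : t ∈ I ↔ t * d = 0 := by simp [I]
  have hψK (x : F) (hx : x ∈ K) : ψ (A' x) ∈ I := by
    rw [hI, mul_comm, ← smul_eq_mul, ← map_smul, (hK x).mp hx, map_zero]
  have hIK (t : R) (ht : t ∈ I) : t • b ∈ K := by
    rw [hK, map_smul, smul_smul, mul_comm, (hI t).mp ht, zero_smul]
  have hKL (x : F) (hx : x ∈ K) : x ∈ L := by
    rw [hL, ← hK, hπx]
    exact K.sub_mem hx (hIK _ (hψK x hx))
  have hLK (x : F) (hx : x ∈ L) : π x ∈ K := (hK _).mpr ((hL x).mp hx)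
  have hππ (x : F) : π (π x) = π x := by
    conv_lhs => rw [hπx x]
    rw [map_sub, map_smul, hπb, smul_zero, sub_zero]
  have hIfg : I.FG := by
    have : I = K.map (ψ ∘ₗ A') := by
      ext t
      refine ⟨fun ht => ⟨t • b, hIK t ht, by simp [hb]⟩, ?_⟩
      rintro ⟨x, hx, rfl⟩
      exact hψK x hx
    exact this ▸ hfg.map _
  have hLfg : L.FG := by
    have : L = K.map π ⊔ Submodule.span R {b} := by
      refine le_antisymm (fun x hx => ?_) (sup_le ?_ ?_)
      · rw [Submodule.mem_sup]
        refine ⟨π x, ⟨π x, hLK x hx, hππ x⟩, ψ (A' x) • b,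
          Submodule.smul_mem _ _ (Submodule.mem_span_singleton_self b), by simp [hπx]⟩
      · rintro _ ⟨x, hx, rfl⟩
        rw [hL, hππ, ← hL]
        exact hKL x hx
      · rw [Submodule.span_singleton_le_iff_mem, hL, hπb, map_zero, smul_zero]
    exact this ▸ (hfg.map _).sup (Submodule.fg_span_singleton b)
  have := hann hIfg
  have := hker hLfg
  let i : K →ₗ[R] L × I :=
    (Submodule.inclusion hKL).prod ((ψ ∘ₗ A').restrict hψK)
  let p : L × I →ₗ[R] K :=
    (π.restrict hLK).coprod (((LinearMap.toSpanSingleton R F b)).restrict hIK)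
  refine .of_retract i p ?_
  ext x
  change π x + ψ (A' x) • b = x
  rw [hπx, sub_add_cancel]

end FinitePresentation

theorem IsArithmetic.finitePresentation_ker {R : Type u} [CommRing R]
    (hR : IsArithmetic R) (hdim : ∀ P : Ideal R, P.IsPrime → P.IsMaximal) {m n : ℕ}
    (A : (Fin m → R) →ₗ[R] (Fin n → R)) (hfg : (LinearMap.ker A).FG) :
    Module.FinitePresentation R (LinearMap.ker A) := by
  induction n with
  | zero =>
    rw [Subsingleton.elim A 0, LinearMap.ker_zero]
    exact .of_equiv Submodule.topEquiv.symm
  | succ n ih =>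
    rcases m.eq_zero_or_pos with rfl | hm
    · infer_instance
    have : NeZero m := ⟨hm.ne'⟩
    refine .of_forall_isMaximal fun M hM => ?_
    obtain ⟨e, heM, he, ⟨i, j⟩, hdvd⟩ := hR.exists_isIdempotentElem_forall_dvd hdim M hM
      (fun k : Fin (n + 1) × Fin m => A (Pi.single k.2 1) k.1)
    have hmem (x : Fin m → R) : x ∈ LinearMap.ker (e • A) ↔ e • A x = 0 := by simp
    have hK (x) (hx : x ∈ LinearMap.ker A) : x ∈ LinearMap.ker (e • A) := by
      rw [hmem, LinearMap.mem_ker.mp hx, smul_zero]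
    have hK' (x) (hx : x ∈ LinearMap.ker (e • A)) : e • x ∈ LinearMap.ker A := by
      rw [LinearMap.mem_ker, map_smul, (hmem x).mp hx]
    have hefg : (LinearMap.ker (e • A)).FG := by
      have : LinearMap.ker (e • A) =
          LinearMap.ker A ⊔ LinearMap.range ((1 - e) • (LinearMap.id : (Fin m → R) →ₗ[R] _)) := by
        refine le_antisymm (fun x hx => ?_) (sup_le hK ?_)
        · rw [Submodule.mem_sup]
          exact ⟨e • x, hK' x hx, (1 - e) • x, ⟨x, rfl⟩, by simp [sub_smul]⟩
        · rintro _ ⟨x, rfl⟩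
          simp [smul_smul, sub_mul, he.eq]
      exact this ▸ hfg.sup (Submodule.FG.of_finite)
    choose r hr using hdvd
    set d := e * A (Pi.single j 1) i with hd
    let r' := Function.update r (i, j) 1
    let A' : (Fin m → R) →ₗ[R] (Fin (n + 1) → R) :=
      Matrix.toLin' (Matrix.of fun k l => r' (k, l))
    have hA'single (k l) : A' (Pi.single l 1) k = r' (k, l) := by
      simp [A']
    have hAA' : e • A = d • A' := by
      refine (Pi.basisFun R (Fin m)).ext fun l => funext fun k => ?_
      simp only [Pi.basisFun_apply, LinearMap.smul_apply, Pi.smul_apply, smul_eq_mul, hA'single]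
      by_cases h : (k, l) = (i, j)
      · obtain ⟨rfl, rfl⟩ := Prod.mk.inj h
        simp [r', hd]
      · simpa [r', h] using hr (k, l)
    have hb : (LinearMap.proj i : (Fin (n + 1) → R) →ₗ[R] R) (A' (Pi.single j 1)) = 1 := by
      simp [hA'single, r']
    have hfp : Module.FinitePresentation R (LinearMap.ker (e • A)) := by
      rw [hAA'] at hefg ⊢
      refine finitePresentation_ker_smul_of_apply_eq_one hb
        (hR.finitePresentation_ker_toSpanSingleton hdim d) ?_ hefg
      set B := (d • A') ∘ₗ (LinearMap.id -
        ((LinearMap.proj i : (Fin (n + 1) → R) →ₗ[R] R) ∘ₗ A').smulRight (Pi.single j 1)) with hB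
      have hBi (x) : B x i = 0 := by
        simp [hB, hA'single, r']
      have hker : LinearMap.ker B = LinearMap.ker (LinearMap.funLeft R R i.succAbove ∘ₗ B) := by
        ext x
        simp only [LinearMap.mem_ker, LinearMap.comp_apply, funext_iff, LinearMap.funLeft_apply,
          Fin.forall_iff_succAbove i, hBi, Pi.zero_apply, true_and]
      rw [hker]
      exact ih _
    refine ⟨e, heM, LinearMap.ker (e • A), inferInstance, inferInstance, hfp,
      Submodule.inclusion hK, (e • LinearMap.id).restrict hK', ?_⟩
    ext x
    simp

/-- Linear maps between finite free modules with finitely generated kernel. -/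
structure FGKernelMap (R : Type u) [CommRing R] where
  source : ℕ
  target : ℕ
  toLinearMap : (Fin source → R) →ₗ[R] (Fin target → R)
  fg_ker : (LinearMap.ker toLinearMap).FG

theorem IsArithmetic.exists_range_eq_ker {R : Type u} [CommRing R]
    (hR : IsArithmetic R) (hdim : ∀ P : Ideal R, P.IsPrime → P.IsMaximal) (A : FGKernelMap R) :
    ∃ (q : ℕ) (C : (Fin q → R) →ₗ[R] (Fin A.source → R)),
      LinearMap.range C = LinearMap.ker A.toLinearMap ∧ (LinearMap.ker C).FG := by
  have := hR.finitePresentation_ker hdim A.toLinearMap A.fg_ker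
  obtain ⟨q, C, hC⟩ := (Submodule.fg_iff_exists_fin_linearMap R _).mp A.fg_ker
  refine ⟨q, C, hC, ?_⟩
  have hC' (x) : C x ∈ LinearMap.ker A.toLinearMap := hC ▸ LinearMap.mem_range_self C x
  have := Module.FinitePresentation.fg_ker (C.codRestrict _ hC') (by
    rintro ⟨y, hy⟩
    rw [← hC] at hy
    obtain ⟨x, rfl⟩ := hy
    exact ⟨x, rfl⟩)
  rwa [LinearMap.ker_codRestrict] at this

/-- A commutative arithmetic ring of Krull dimension 0 (every prime
ideal is maximal) has `λ`-dimension at most 2. -/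
theorem lambdaDim_le_two_of_isArithmetic_of_krullDimZero (R : Type u) [CommRing R]
    (hR : IsArithmetic R) (hdim : ∀ P : Ideal R, P.IsPrime → P.IsMaximal) :
    LambdaDimLE R 2 := by
  rintro E _ _ ⟨k, f, g, hg, hg0, hf⟩ m
  choose q C hrange hker using hR.exists_range_eq_ker hdim
  let a (i : ℕ) : FGKernelMap R :=
    i.rec ⟨k 1, k 0, f 0, hf 0 one_lt_two ▸ Submodule.FG.of_finite⟩
      fun _ A => ⟨q A, A.source, C A, hker A⟩
  exact ⟨fun i => (a i).target, fun i => (a i).toLinearMap, g, hg, fun _ => hg0 two_pos,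
    fun i _ => hrange (a i)⟩
end

section
/- Let R be a valuation ring and let r, s ∈ R with rs ≠ 0. Then (i) (0 : rs) = ((0 : r) : s) and (0 : r) = s·(0 : rs); and (ii) if (0 : r) ≠ 0, then (0 : r) is a finitely generated ideal if and only if (0 : rs) is a finitely generated ideal. -/
open DirectSum

universe u

theorem dvd_total_of_ideal_le_total {R : Type*} [CommRing R]
    (hval : ∀ I J : Ideal R, I ≤ J ∨ J ≤ I) (a b : R) : a ∣ b ∨ b ∣ a := by
  rcases hval (Ideal.span {a}) (Ideal.span {b}) with h | h
  · exact Or.inr (Ideal.span_singleton_le_span_singleton.1 h)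
  · exact Or.inl (Ideal.span_singleton_le_span_singleton.1 h)

theorem isBezout_of_ideal_le_total {R : Type*} [CommRing R]
    (hval : ∀ I J : Ideal R, I ≤ J ∨ J ≤ I) : IsBezout R := by
  refine IsBezout.iff_span_pair_isPrincipal.2 fun a b => ?_
  rw [Ideal.span_insert]
  rcases hval (Ideal.span {a}) (Ideal.span {b}) with h | h
  · rw [sup_eq_right.2 h]
    exact ⟨b, rfl⟩
  · rw [sup_eq_left.2 h]
    exact ⟨a, rfl⟩

/-- In a valuation ring, a common factor `s` may be cancelled from `s * y ∣ s * z` as soon as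
`s * y ≠ 0`. -/
theorem dvd_of_mul_dvd_mul_of_ne_zero {R : Type*} [CommRing R] [IsLocalRing R]
    (hval : ∀ I J : Ideal R, I ≤ J ∨ J ≤ I) {s y z : R} (hy : s * y ≠ 0)
    (h : s * y ∣ s * z) : y ∣ z := by
  rcases dvd_total_of_ideal_le_total hval y z with hyz | ⟨c, rfl⟩
  · exact hyz
  obtain ⟨d, hd⟩ := h
  rcases IsLocalRing.isUnit_or_isUnit_one_sub_self (c * d) with hu | hu
  · exact (isUnit_of_mul_isUnit_left hu).mul_right_dvd.2 dvd_rfl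
  · have hz : s * z = 0 := (hu.mul_left_eq_zero).1 (by linear_combination hd)
    exact absurd (by rw [← mul_assoc, hz, zero_mul]) hy

/-- In a valuation ring, for `r, s` with `rs ≠ 0`:
(i) `(0 : rs) = ((0 : r) : s)` and `(0 : r) = s·(0 : rs)`;
(ii) if `(0 : r) ≠ 0` then `(0 : r)` is finitely generated iff `(0 : rs)` is. -/
theorem torsionOf_mul_eq_colon_and_smul (R : Type u) [CommRing R] [IsLocalRing R]
    (hval : ∀ I J : Ideal R, I ≤ J ∨ J ≤ I) (r s : R) (hrs : r * s ≠ 0) :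
    Ideal.torsionOf R R (r * s) = (Ideal.torsionOf R R r).colon (Ideal.span {s}) ∧
    Ideal.torsionOf R R r = Ideal.span {s} * Ideal.torsionOf R R (r * s) ∧
    (Ideal.torsionOf R R r ≠ ⊥ →
      ((Ideal.torsionOf R R r).FG ↔ (Ideal.torsionOf R R (r * s)).FG)) := by
  have hsmul : Ideal.torsionOf R R r = Ideal.span {s} * Ideal.torsionOf R R (r * s) := by
    ext x
    simp only [Ideal.mem_span_singleton_mul, Ideal.mem_torsionOf_iff, smul_eq_mul]
    constructor
    · intro hx
      rcases dvd_total_of_ideal_le_total hval s x with ⟨y, rfl⟩ | ⟨c, rfl⟩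
      · exact ⟨y, by linear_combination hx, rfl⟩
      · exact absurd (by linear_combination c * hx) hrs
    · rintro ⟨y, hy, rfl⟩
      linear_combination hy
  refine ⟨?_, hsmul, fun hne => ⟨fun hfg => ?_, fun hfg => ?_⟩⟩
  · ext x
    rw [Ideal.mem_colon_span_singleton, Ideal.mem_torsionOf_iff, Ideal.mem_torsionOf_iff,
      smul_eq_mul, smul_eq_mul, mul_assoc, mul_comm s r]
  · have := isBezout_of_ideal_le_total hval
    obtain ⟨t, ht⟩ := (IsBezout.isPrincipal_of_FG _ hfg).principal
    rw [Ideal.submodule_span_eq] at ht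
    have htmem : t ∈ Ideal.span {s} * Ideal.torsionOf R R (r * s) := by
      rw [← hsmul, ht]
      exact Ideal.mem_span_singleton_self t
    obtain ⟨y, hy, rfl⟩ := Ideal.mem_span_singleton_mul.1 htmem
    have hsy : s * y ≠ 0 := fun h => hne (by rw [ht, h, Ideal.span_singleton_eq_bot])
    have hspan : Ideal.torsionOf R R (r * s) = Ideal.span {y} := by
      refine le_antisymm (fun z hz => ?_) ((Ideal.span_singleton_le_iff_mem _).2 hy)
      refine Ideal.mem_span_singleton.2 (dvd_of_mul_dvd_mul_of_ne_zero hval hsy ?_)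
      rw [← Ideal.mem_span_singleton, ← ht, hsmul]
      exact Ideal.mul_mem_mul (Ideal.mem_span_singleton_self s) hz
    rw [hspan]
    exact ⟨{y}, by simp⟩
  · rw [hsmul]
    exact Submodule.FG.mul ⟨{s}, by simp⟩ hfg
end

section
/- Let R be a semi-local commutative arithmetic ring. Then the λ-dimension of R is at most 2, and R is coherent if and only if R_M is coherent for every maximal ideal M of R. -/
open DirectSum

universe u

/-- In a local ring with totally ordered ideals, if `b` generates the annihilator of `a`,
then the annihilator of `b` is principal. -/
lemma exists_ker_toSpanSingleton_eq_span {A : Type*} [CommRing A] [IsLocalRing A]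
    (hA : ∀ x y : A, x ∣ y ∨ y ∣ x) {a b : A}
    (hab : LinearMap.ker (LinearMap.toSpanSingleton A A a) = Ideal.span {b}) :
    ∃ c, LinearMap.ker (LinearMap.toSpanSingleton A A b) = Ideal.span {c} := by
  have mem (x : A) : x * a = 0 ↔ b ∣ x := by
    rw [← Ideal.mem_span_singleton, ← hab]; simp
  have hba : b * a = 0 := (mem b).2 dvd_rfl
  by_cases hb : b = 0
  · exact ⟨1, by ext; simp [hb]⟩
  refine ⟨a, ?_⟩
  ext c
  simp only [LinearMap.mem_ker, LinearMap.toSpanSingleton_apply, smul_eq_mul,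
    Ideal.mem_span_singleton]
  constructor
  · intro hc
    rcases hA a c with h | ⟨r, rfl⟩
    · exact h
    by_cases hr : IsUnit r
    · exact (hr.mul_right_dvd).2 dvd_rfl
    rcases hA b r with ⟨t, rfl⟩ | ⟨t, rfl⟩
    · have h0 : c * (b * t) = 0 := by rw [← mul_assoc, hc, zero_mul]
      have hu : IsUnit b := isUnit_of_dvd_one ((mem 1).1 (by rw [one_mul, h0]))
      have : c = 0 := by simpa [hu.mul_left_eq_zero] using hc
      simp [this]
    · obtain ⟨s, hs⟩ := (mem t).1 (by linear_combination hc)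
      have hu : IsUnit (1 - r * s) := by
        refine (IsLocalRing.isUnit_or_isUnit_one_sub_self (r * s)).resolve_left fun h => hr ?_
        exact isUnit_of_mul_isUnit_left h
      have h0 : r * t * (1 - r * s) = 0 := by linear_combination r * hs
      exact absurd (hu.mul_left_eq_zero.1 h0) hb
  · rintro ⟨r, rfl⟩
    linear_combination r * hba

/-- Over a local ring with totally ordered ideals, a finitely generated annihilator of an element
is finitely presented. -/
lemma finitePresentation_ker_toSpanSingleton {A : Type*} [CommRing A] [IsLocalRing A]
    (hA : ∀ x y : A, x ∣ y ∨ y ∣ x) (a : A)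
    (h : (LinearMap.ker (LinearMap.toSpanSingleton A A a)).FG) :
    Module.FinitePresentation A (LinearMap.ker (LinearMap.toSpanSingleton A A a)) := by
  have hbez : IsBezout A := IsBezout.iff_span_pair_isPrincipal.2 fun x y => by
    rcases hA x y with hxy | hxy
    · exact ⟨x, le_antisymm (by rw [Ideal.span_le]; rintro z (rfl | rfl) <;>
        simp [Ideal.mem_span_singleton, *]) (Ideal.span_mono (by simp))⟩
    · exact ⟨y, le_antisymm (by rw [Ideal.span_le]; rintro z (rfl | rfl) <;>
        simp [Ideal.mem_span_singleton, *]) (Ideal.span_mono (by simp))⟩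
  obtain ⟨b, hb⟩ := (IsBezout.isPrincipal_of_FG _ h).principal
  obtain ⟨c, hc⟩ := exists_ker_toSpanSingleton_eq_span hA hb
  rw [hb, ← LinearMap.range_toSpanSingleton]
  refine Module.finitePresentation_of_free_of_surjective
    (LinearMap.toSpanSingleton A A b).rangeRestrict (LinearMap.surjective_rangeRestrict _) ?_
  rw [LinearMap.ker_rangeRestrict, hc]
  exact ⟨{c}, by simp⟩

/-- A nonzero linear map between finite free modules, over a ring whose elements are totally
ordered by divisibility, is a multiple `d • g` of a map `g` taking some vector to a vector with
a coordinate equal to `1`. -/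
lemma LinearMap.exists_eq_smul_of_dvd_total {A P Q : Type*} [CommRing A] [AddCommGroup P]
    [Module A P] [AddCommGroup Q] [Module A Q] [Module.Free A P] [Module.Finite A P]
    [Module.Free A Q] [Module.Finite A Q]
    (hA : ∀ x y : A, x ∣ y ∨ y ∣ x) (f : P →ₗ[A] Q) (hf : f ≠ 0) :
    ∃ (d : A) (g : P →ₗ[A] Q) (e : P) (π : Q →ₗ[A] A), f = d • g ∧ π (g e) = 1 := by
  classical
  let c := Module.Free.chooseBasis A P
  let b := Module.Free.chooseBasis A Q
  let κ := Module.Free.ChooseBasisIndex A P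
  let ι := Module.Free.ChooseBasisIndex A Q
  let m : κ × ι → A := fun p => b.repr (f (c p.1)) p.2
  have : Nonempty (κ × ι) := by
    by_contra hne
    refine hf (c.ext fun k => b.repr.injective (Finsupp.ext fun i => ?_))
    exact absurd ⟨(k, i)⟩ hne
  obtain ⟨⟨k, i⟩, hki⟩ := Set.univ.toFinite.exists_maximalFor (fun p => Ideal.span {m p}) _
    ⟨Classical.arbitrary _, trivial⟩
  have hdvd (p) : m (k, i) ∣ m p := by
    rcases hA (m (k, i)) (m p) with h | h
    · exact h
    · exact Ideal.span_singleton_le_span_singleton.1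
        (hki.2 trivial (Ideal.span_singleton_le_span_singleton.2 h))
  choose q hq using hdvd
  let q' : κ × ι → A := Function.update q (k, i) 1
  have hq' (p) : m p = m (k, i) * q' p := by
    by_cases hp : p = (k, i)
    · simp [q', hp]
    · simp [q', hp, ← hq p]
  refine ⟨m (k, i), c.constr A fun k' => ∑ i', q' (k', i') • b i', c k, b.coord i, ?_, ?_⟩
  · refine c.ext fun k' => ?_
    rw [LinearMap.smul_apply, c.constr_basis, Finset.smul_sum, ← b.sum_repr (f (c k'))]
    refine Finset.sum_congr rfl fun i' _ => ?_
    rw [smul_smul, ← hq']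
  · simp [c.constr_basis, q', Finsupp.single_apply]

/-- The splitting of a module by a linear form `φ` and a vector `e` with `φ e = 1`. -/
def LinearMap.equivProdKer {A P : Type*} [CommRing A] [AddCommGroup P] [Module A P]
    (φ : P →ₗ[A] A) (e : P) (h : φ e = 1) : P ≃ₗ[A] A × LinearMap.ker φ where
  toFun x := (φ x, ⟨x - φ x • e, by simp [h]⟩)
  map_add' x y := by ext <;> simp; module
  map_smul' r x := by ext <;> simp; module
  invFun p := p.1 • e + p.2
  left_inv x := by simp
  right_inv p := by ext <;> simp [h]

/-- Over a local ring with totally ordered ideals, if a map between finite free modules has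
finitely generated kernel, then this kernel is finitely presented. -/
lemma finitePresentation_ker_of_fg {A Q : Type*} [CommRing A] [IsLocalRing A]
    [AddCommGroup Q] [Module A Q] [Module.Free A Q] [Module.Finite A Q]
    (hA : ∀ x y : A, x ∣ y ∨ y ∣ x) (n : ℕ) :
    ∀ {P : Type*} [AddCommGroup P] [Module A P] [Module.Free A P] [Module.Finite A P]
      (_ : Module.finrank A P = n) (f : P →ₗ[A] Q) (_ : (LinearMap.ker f).FG),
      Module.FinitePresentation A (LinearMap.ker f) := by
  induction n with
  | zero =>
    intro P _ _ _ _ hn f _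
    have : Subsingleton P := Module.finrank_eq_zero_iff_of_free A P |>.1 hn
    infer_instance
  | succ n ih =>
    intro P _ _ _ _ hn f hfg
    by_cases hf : f = 0
    · rw [hf, LinearMap.ker_zero]
      have := Module.finitePresentation_of_projective A P
      exact .of_equiv (Submodule.topEquiv (R := A) (M := P)).symm
    obtain ⟨d, g, e, π, rfl, he⟩ := f.exists_eq_smul_of_dvd_total hA hf
    let φ : P →ₗ[A] A := π ∘ₗ g
    let E := φ.equivProdKer e he
    have : Module.Finite A (LinearMap.ker φ) :=
      .of_surjective (LinearMap.snd A A (LinearMap.ker φ) ∘ₗ E.toLinearMap)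
        (Prod.snd_surjective.comp E.surjective)
    have : Module.Projective A (LinearMap.ker φ) :=
      .of_split (E.symm.toLinearMap ∘ₗ LinearMap.inr A A (LinearMap.ker φ))
        (LinearMap.snd A A (LinearMap.ker φ) ∘ₗ E.toLinearMap)
        (by ext; simp)
    have : Module.Free A (LinearMap.ker φ) := Module.free_of_flat_of_isLocalRing
    have hrank : Module.finrank A (LinearMap.ker φ) = n := by
      have := E.finrank_eq
      rw [Module.finrank_prod, Module.finrank_self] at this
      omega
    let f' : LinearMap.ker φ →ₗ[A] Q := (d • g) ∘ₗ (LinearMap.ker φ).subtype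
    let K₀ := LinearMap.ker (LinearMap.toSpanSingleton A A d)
    have key (x : P) : x ∈ LinearMap.ker (d • g) ↔ (E x).1 ∈ K₀ ∧ (E x).2 ∈ LinearMap.ker f' := by
      have h1 : (E x).1 = π (g x) := rfl
      have h2 : f' (E x).2 = d • g x - (π (g x) * d) • g e := by
        change d • g (x - π (g x) • e) = _
        simp [smul_sub, smul_smul, mul_comm]
      have h3 : (E x).1 ∈ K₀ ↔ π (g x) * d = 0 := by rw [h1]; simp [K₀]
      rw [h3, LinearMap.mem_ker, LinearMap.mem_ker, h2, LinearMap.smul_apply]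
      constructor
      · intro hx
        have : π (g x) * d = 0 := by simpa [mul_comm] using congrArg π hx
        simp [hx, this]
      · rintro ⟨hx, hx'⟩
        simpa [hx] using hx'
    let e' : LinearMap.ker (d • g) ≃ₗ[A] K₀ × LinearMap.ker f' :=
      { toFun x := (⟨(E x).1, ((key x).1 x.2).1⟩, ⟨(E x).2, ((key x).1 x.2).2⟩)
        map_add' x y := by ext <;> simp
        map_smul' r x := by ext <;> simp
        invFun p := ⟨E.symm (p.1, p.2), (key _).2 (by simp)⟩
        left_inv x := by simp
        right_inv p := by simp }
    have : Module.Finite A (LinearMap.ker (d • g)) := Module.Finite.iff_fg.2 hfg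
    have hK₀ : Module.Finite A K₀ := .of_surjective (LinearMap.fst A _ _ ∘ₗ e'.toLinearMap)
      (Prod.fst_surjective.comp e'.surjective)
    have hf' : Module.Finite A (LinearMap.ker f') :=
      .of_surjective (LinearMap.snd A _ _ ∘ₗ e'.toLinearMap)
        (Prod.snd_surjective.comp e'.surjective)
    have := finitePresentation_ker_toSpanSingleton hA d (Module.Finite.iff_fg.1 hK₀)
    have := ih hrank f' (Module.Finite.iff_fg.1 hf')
    exact .of_equiv e'.symm

/-- In an arithmetic semi-local ring, the kernel of a map of finite free modules is finitely
generated as soon as its range is the kernel of a map of finite free modules. -/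
lemma fg_ker_of_range_eq_ker {R : Type u} [CommRing R]
    (hR : IsArithmetic R) [Finite (MaximalSpectrum R)] {a b c : ℕ}
    (f : (Fin a → R) →ₗ[R] (Fin b → R)) (g : (Fin b → R) →ₗ[R] (Fin c → R))
    (h : LinearMap.range f = LinearMap.ker g) : (LinearMap.ker f).FG := by
  refine Submodule.fg_of_localized_maximal _ fun M hM => ?_
  have hA (x y : Localization.AtPrime M) : x ∣ y ∨ y ∣ x := by
    simpa [Ideal.mem_span_singleton, or_comm] using
      hR M hM (Ideal.span {x}) (Ideal.span {y})
  let S := M.primeCompl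
  let L (n : ℕ) := LocalizedModule.mkLinearMap S (Fin n → R)
  have hfree (n : ℕ) : Module.Free (Localization.AtPrime M) (LocalizedModule S (Fin n → R)) :=
    Module.free_of_isLocalizedModule S (L n)
  let f' := (IsLocalizedModule.map S (L a) (L b) f).extendScalarsOfIsLocalization S
    (Localization.AtPrime M)
  let g' := (IsLocalizedModule.map S (L b) (L c) g).extendScalarsOfIsLocalization S
    (Localization.AtPrime M)
  have hf : (LinearMap.ker f).localized S = LinearMap.ker f' :=
    LinearMap.localized'_ker_eq_ker_localizedMap _ S (L a) (L b) f
  have hfg : LinearMap.range f' = LinearMap.ker g' := by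
    rw [← LinearMap.localized'_range_eq_range_localizedMap, h,
      LinearMap.localized'_ker_eq_ker_localizedMap _ S (L b) (L c) g]
  have hfin : (LinearMap.ker g').FG := by
    rw [← hfg, LinearMap.range_eq_map]
    exact Module.Finite.fg_top.map _
  have hfp := finitePresentation_ker_of_fg hA _ rfl g' hfin
  rw [← hfg] at hfp
  have := Module.FinitePresentation.fg_ker (R := Localization.AtPrime M) (N := LinearMap.range f')
    f'.rangeRestrict f'.surjective_rangeRestrict
  rwa [LinearMap.ker_rangeRestrict, ← hf] at this

/-- Splicing a presentation of the kernel of `g : R^a → E` with `g`. -/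
lemma HasFiniteNPresentation.of_ker {R E : Type u} [CommRing R] [AddCommGroup E] [Module R E]
    {a n : ℕ} (g : (Fin a → R) →ₗ[R] E) (hg : Function.Surjective g)
    (h : HasFiniteNPresentation R (LinearMap.ker g) n) : HasFiniteNPresentation R E (n + 1) := by
  obtain ⟨k, f, p, hp, h0, h1⟩ := h
  refine ⟨fun | 0 => a | i + 1 => k i,
    fun | 0 => (LinearMap.ker g).subtype ∘ₗ p | i + 1 => f i, g, hg, fun _ => ?_, ?_⟩
  · rw [LinearMap.range_comp, LinearMap.range_eq_top.2 hp, Submodule.map_top,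
      Submodule.range_subtype]
  · rintro (_ | i) hi
    · rw [LinearMap.ker_comp, Submodule.ker_subtype, ← LinearMap.ker]
      exact h0 (by omega)
    · exact h1 i (by omega)

/-- If the kernel of a map of finite free modules is finitely generated whenever its range is
again the kernel of such a map, then the `λ`-dimension is at most `2`. -/
lemma lambdaDimLE_two_of_fg_ker {R : Type u} [CommRing R]
    (hR : ∀ {a b c : ℕ} (f : (Fin a → R) →ₗ[R] (Fin b → R)) (g : (Fin b → R) →ₗ[R] (Fin c → R)),
      LinearMap.range f = LinearMap.ker g → (LinearMap.ker f).FG) : LambdaDimLE R 2 := by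
  intro E _ _ h m
  induction m generalizing E with
  | zero =>
    obtain ⟨k, f, g, hg, -⟩ := h
    exact ⟨k, f, g, hg, by simp, by simp⟩
  | succ m ih =>
    obtain ⟨k, f, g, hg, h0, h1⟩ := h
    refine .of_ker g hg (ih _ ?_)
    have h0 := h0 (by simp)
    have h1 := h1 0 (by simp)
    obtain ⟨a, p, hp⟩ := (Submodule.fg_iff_exists_fin_linearMap _ _).1 (hR (f 1) (f 0) h1)
    have hmem (x) : f 0 x ∈ LinearMap.ker g := h0 ▸ LinearMap.mem_range_self _ x
    refine ⟨fun | 0 => k 1 | 1 => k 2 | 2 => a | _ + 3 => 0,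
      fun | 0 => f 1 | 1 => p | _ + 2 => 0, (f 0).codRestrict _ hmem, ?_, fun _ => ?_, ?_⟩
    · rintro ⟨y, hy⟩
      obtain ⟨x, rfl⟩ := h0.ge hy
      exact ⟨x, rfl⟩
    · rw [LinearMap.ker_codRestrict]
      exact h1
    · rintro (_ | i) hi
      · exact hp
      · omega

/-- Localizations of coherent rings are coherent. -/
lemma IsCoherentRing.localization {R : Type u} [CommRing R] (h : IsCoherentRing R)
    (S : Submonoid R) : IsCoherentRing (Localization S) := by
  classical
  intro I hI
  let L := Algebra.linearMap R (Localization S)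
  have hloc : Submodule.localized' (Localization S) S L (I.comap (algebraMap R _)) = I := by
    simp [L, Ideal.localized'_eq_map, IsLocalization.map_under S]
  rw [← hloc, Submodule.localized'_eq_span] at hI
  obtain ⟨s, hs, hs'⟩ := (Submodule.fg_span_iff_fg_span_finset_subset _).1 hI
  obtain ⟨t, ht, rfl⟩ := Finset.subset_set_image_iff.1 hs
  let J : Ideal R := Ideal.span t
  have hJ : Submodule.localized' (Localization S) S L J = I := by
    rw [← hloc, Submodule.localized'_eq_span _ _ _ (I.comap _), hs', Finset.coe_image]
    exact Submodule.localized'_span _ _ _ _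
  have := h J ⟨t, rfl⟩
  rw [← hJ]
  exact FinitePresentation.of_isBaseChange (J.toLocalized' (Localization S) S L)
    ((isLocalizedModule_iff_isBaseChange S _ _).1 inferInstance)

/-- A semi-local ring that is coherent locally at all maximal ideals is coherent. -/
lemma IsCoherentRing.of_localization_maximal {R : Type u} [CommRing R]
    [Finite (MaximalSpectrum R)]
    (h : ∀ (M : Ideal R) [M.IsMaximal], IsCoherentRing (Localization.AtPrime M)) :
    IsCoherentRing R := by
  intro I hI
  have : Module.Finite R I := Module.Finite.iff_fg.2 hI
  obtain ⟨n, g, hg⟩ := Module.Finite.exists_fin' R I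
  refine Module.finitePresentation_of_free_of_surjective g hg
    (Submodule.fg_of_localized_maximal _ fun M _ => ?_)
  let S := M.primeCompl
  let A := Localization.AtPrime M
  let L := I.toLocalized' A S (Algebra.linearMap R A)
  have := h M (I.localized' A S (Algebra.linearMap R A)) (Submodule.localized'_fg _ _ _ hI)
  have hker := LinearMap.localized'_ker_eq_ker_localizedMap A S
    (LocalizedModule.mkLinearMap S (Fin n → R)) L g
  rw [Submodule.localized, hker]
  exact Module.FinitePresentation.fg_ker _ (IsLocalizedModule.map_surjective S _ L g hg)

/-- A semi-local commutative arithmetic ring has `λ`-dimension at most 2,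
and is coherent iff it is locally coherent. -/
theorem lambdaDim_le_two_of_isArithmetic_semilocal (R : Type u) [CommRing R]
    (hR : IsArithmetic R) (hsl : {M : Ideal R | M.IsMaximal}.Finite) :
    LambdaDimLE R 2 ∧
    (IsCoherentRing R ↔ ∀ (M : Ideal R) (hM : M.IsMaximal),
      letI := hM.isPrime
      IsCoherentRing (Localization.AtPrime M)) := by
  have : Finite (MaximalSpectrum R) := (MaximalSpectrum.equivSubtype R).finite_iff.2 hsl
  refine ⟨lambdaDimLE_two_of_fg_ker fun f g => fg_ker_of_range_eq_ker hR f g, fun h M hM => ?_,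
    fun h => .of_localization_maximal fun M hM => h M hM⟩
  have := hM.isPrime
  exact h.localization M.primeCompl
end
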